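/- Let μ be a probability measure on ℝ whose moment sequence satisfies Carleman's condition ∑_{k≥1} (∫ x^{2k} dμ)^{-1/(2k)} = ∞. Then μ is moment-determinate: any probability measure ν on ℝ with ∫ x^m dν = ∫ x^m dμ for all m ∈ ℕ equals μ. -/

import Mathlib

open MeasureTheory

open scoped ContDiff

/-- Taylor's formula at order `n` with the Lagrange form of the remainder bound. -/
theorem norm_sub_taylor_sum_le {E : Type*} [NormedAddCommGroup E] [NormedSpace ℝ E] {C : ℝ}
    (n : ℕ) {f : ℝ → E} (hf : ContDiff ℝ ∞ f) (hC : ∀ s, ‖iteratedDeriv n f s‖ ≤ C)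
    (t : ℝ) {h : ℝ} (hh : 0 ≤ h) :
    ‖f (t + h) - ∑ j ∈ Finset.range n, (h ^ j / (j.factorial : ℝ)) • iteratedDeriv j f t‖
      ≤ C * h ^ n / n.factorial := by
  induction n generalizing f h with
  | zero => simpa using hC (t + h)
  | succ n ih =>
    have hf' : ContDiff ℝ ∞ (deriv f) := (contDiff_infty_iff_deriv.1 hf).2
    have hpow (j : ℕ) (x : ℝ) : HasDerivAt (fun y : ℝ => y ^ (j + 1) / ((j + 1).factorial : ℝ))
        (x ^ j / (j.factorial : ℝ)) x := by
      refine ((hasDerivAt_pow (j + 1) x).div_const ((j + 1).factorial : ℝ)).congr_deriv ?_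
      rw [Nat.factorial_succ]
      push_cast
      field_simp
    have hR (x : ℝ) : HasDerivAt (fun y => f (t + y) - ∑ j ∈ Finset.range (n + 1),
          (y ^ j / (j.factorial : ℝ)) • iteratedDeriv j f t)
        (deriv f (t + x) - ∑ j ∈ Finset.range n,
          (x ^ j / (j.factorial : ℝ)) • iteratedDeriv j (deriv f) t) x := by
      simp_rw [Finset.sum_range_succ', iteratedDeriv_succ']
      have h1 : HasDerivAt (fun y => f (t + y)) (deriv f (t + x)) x :=
        ((hf.differentiable (by simp)) (t + x)).hasDerivAt.comp_const_add t x
      refine h1.sub ?_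
      simp only [pow_zero, iteratedDeriv_zero]
      exact (HasDerivAt.fun_sum fun j _ => (hpow j x).smul_const _).add_const _
    have hB (x : ℝ) : HasDerivAt (fun y : ℝ => C * y ^ (n + 1) / ((n + 1).factorial : ℝ))
        (C * x ^ n / (n.factorial : ℝ)) x := by
      simpa only [mul_div_assoc] using (hpow n x).const_mul C
    refine image_norm_le_of_norm_deriv_right_le_deriv_boundary (a := 0) (b := h)
      (fun x _ => (hR x).continuousAt.continuousWithinAt)
      (fun x _ => (hR x).hasDerivWithinAt) ?_ hB ?_ (Set.right_mem_Icc.2 hh)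
    · simp [Finset.sum_range_succ']
    · intro x hx
      exact ih hf' (fun s => by simpa only [iteratedDeriv_succ'] using hC s) hx.1

/-- **Carleman's inequality**, in the form of a summability statement. -/
theorem summable_geom_mean {a : ℕ → ℝ} (ha : ∀ n, 0 ≤ a n) (hs : Summable a) :
    Summable fun n : ℕ => (∏ i ∈ Finset.range (n + 1), a i) ^ (1 / ((n : ℝ) + 1)) := by
  set P : ℕ → ℝ := fun n => ∑ i ∈ Finset.range n, ((i : ℝ) + 1) * a i with hP
  have hP0 (n : ℕ) : 0 ≤ P n :=
    Finset.sum_nonneg fun i _ => mul_nonneg (by positivity) (ha i)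
  have htel (M : ℕ) : ∑ n ∈ Finset.range M, P (n + 1) / (((n : ℝ) + 1) * (n + 2)) + P M / (M + 1)
      = ∑ i ∈ Finset.range M, a i := by
    induction M with
    | zero => simp [hP]
    | succ M ih =>
      rw [Finset.sum_range_succ, Finset.sum_range_succ, ← ih]
      have : P (M + 1) = P M + ((M : ℝ) + 1) * a M := Finset.sum_range_succ _ _
      rw [this]
      push_cast
      field_simp
      ring
  have hsum : Summable fun n : ℕ => P (n + 1) / (((n : ℝ) + 1) * (n + 2)) := by
    refine summable_of_sum_range_le (c := ∑' i, a i)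
      (fun n => div_nonneg (hP0 _) (by positivity)) fun M => ?_
    have := hs.sum_le_tsum (Finset.range M) fun i _ => ha i
    have := div_nonneg (hP0 M) (by positivity : (0 : ℝ) ≤ M + 1)
    linarith [htel M]
  refine Summable.of_nonneg_of_le
    (fun n => Real.rpow_nonneg (Finset.prod_nonneg fun i _ => ha i) _) (fun n => ?_)
    (hsum.mul_left (2 * Real.exp 1))
  have hn : (0 : ℝ) < n + 1 := by positivity
  have hprod : 0 ≤ ∏ i ∈ Finset.range (n + 1), a i := Finset.prod_nonneg fun i _ => ha i
  have hamgm := Real.geom_mean_le_arith_mean (Finset.range (n + 1)) (fun _ => (1 : ℝ))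
    (fun i => ((i : ℝ) + 1) * a i) (fun _ _ => zero_le_one) (by simpa using hn)
    (fun i _ => mul_nonneg (by positivity) (ha i))
  simp only [Real.rpow_one, Finset.prod_mul_distrib, one_mul, Finset.sum_const, Finset.card_range,
    nsmul_eq_mul, mul_one] at hamgm
  push_cast at hamgm
  have hfac : ∏ i ∈ Finset.range (n + 1), ((i : ℝ) + 1) = (n + 1).factorial := by
    rw [← Finset.prod_range_add_one_eq_factorial]
    push_cast
    rfl
  rw [hfac, Real.mul_rpow (by positivity) hprod] at hamgm
  have hlow : ((n : ℝ) + 1) / Real.exp 1 ≤ ((n + 1).factorial : ℝ) ^ ((n : ℝ) + 1)⁻¹ := by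
    rw [Real.le_rpow_inv_iff_of_pos (by positivity) (by positivity) hn]
    have h1 := Real.pow_div_factorial_le_exp ((n : ℝ) + 1) hn.le (n + 1)
    have h2 : ((n : ℝ) + 1) = ((n + 1 : ℕ) : ℝ) := by push_cast; rfl
    rw [h2, Real.rpow_natCast, div_pow, ← Real.exp_nat_mul, mul_one, div_le_iff₀ (by positivity)]
    rw [h2, div_le_iff₀ (by positivity)] at h1
    linarith
  have hg := Real.rpow_nonneg hprod ((n : ℝ) + 1)⁻¹
  have hmul := (mul_le_mul_of_nonneg_right hlow hg).trans hamgm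
  rw [one_div]
  change _ ≤ P (n + 1) / _ at hmul
  have hstep : (∏ i ∈ Finset.range (n + 1), a i) ^ ((n : ℝ) + 1)⁻¹
      ≤ Real.exp 1 * (P (n + 1) / ((n + 1) * (n + 1))) := by
    rw [div_mul_eq_mul_div, div_le_iff₀ (by positivity)] at hmul
    rw [← mul_le_mul_iff_of_pos_left hn]
    refine hmul.trans (le_of_eq ?_)
    field_simp
  refine hstep.trans ?_
  have : P (n + 1) / (((n : ℝ) + 1) * (n + 1)) ≤ 2 * (P (n + 1) / ((n + 1) * (n + 2))) := by
    rw [← mul_div_assoc, div_le_div_iff₀ (by positivity) (by positivity)]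
    have h3 : ((n : ℝ) + 1) * (n + 2) ≤ 2 * ((n + 1) * (n + 1)) := by nlinarith
    nlinarith [mul_le_mul_of_nonneg_left h3 (hP0 (n + 1))]
  nlinarith [mul_le_mul_of_nonneg_left this (Real.exp_pos 1).le]

/-- The propagation step in Bang's proof of the Denjoy–Carleman theorem: moving by a small multiple
of `S N / S (N + 1)` worsens the bound on the derivatives at most by a factor `exp 1`. -/
theorem norm_iteratedDeriv_add_le_exp {E : Type*} [NormedAddCommGroup E] [NormedSpace ℝ E]
    {f : ℝ → E} (hf : ContDiff ℝ ∞ f) {S : ℕ → ℝ} (hS : ∀ n, 0 < S n)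
    (hlog : Monotone fun n => S (n + 1) / S n) (hbound : ∀ n t, ‖iteratedDeriv n f t‖ ≤ S n)
    {N : ℕ} {t : ℝ} (ht : ∀ k : ℕ, ‖iteratedDeriv k f t‖ ≤ Real.exp ((k : ℝ) - (N + 1)) * S k)
    {h : ℝ} (hh : 0 ≤ h) (hhN : h ≤ Real.exp (-1) * (S N / S (N + 1))) (k : ℕ) :
    ‖iteratedDeriv k f (t + h)‖ ≤ Real.exp ((k : ℝ) - N) * S k := by
  rcases le_total N k with hk | hk
  · refine (hbound k _).trans (le_mul_of_one_le_left (hS k).le (Real.one_le_exp ?_))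
    exact sub_nonneg.2 (Nat.cast_le.2 hk)
  obtain ⟨d, rfl⟩ := Nat.exists_eq_add_of_le hk
  set r := S (k + d + 1) / S (k + d) with hr
  have hr0 : 0 < r := div_pos (hS _) (hS _)
  have hratio (j : ℕ) (hj : j ≤ d + 1) : S (k + j) ≤ S k * r ^ j := by
    induction j with
    | zero => simp
    | succ j ih =>
      have h1 : S (k + j + 1) / S (k + j) ≤ r := hlog (by omega)
      rw [div_le_iff₀ (hS _)] at h1
      calc S (k + (j + 1)) ≤ r * S (k + j) := h1
        _ ≤ r * (S k * r ^ j) := by gcongr; exact ih (by omega)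
        _ = S k * r ^ (j + 1) := by ring
  have hx : h * Real.exp 1 * r ≤ 1 := by
    have : h * Real.exp 1 * r
        ≤ Real.exp (-1) * (S (k + d) / S (k + d + 1)) * Real.exp 1 * r := by gcongr
    refine this.trans (le_of_eq ?_)
    rw [hr, Real.exp_neg]
    have := hS (k + d)
    have := hS (k + d + 1)
    field_simp
  have hit (j : ℕ) : iteratedDeriv j (iteratedDeriv k f) = iteratedDeriv (k + j) f := by
    simp only [iteratedDeriv_eq_iterate, ← Function.iterate_add_apply, add_comm]
  have htaylor := norm_sub_taylor_sum_le (d + 1) (f := iteratedDeriv k f) (C := S (k + d + 1))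
    (by simpa only [iteratedDeriv_eq_iterate] using hf.iterate_deriv k)
    (fun s => by rw [hit]; exact hbound _ s) t hh
  simp only [hit] at htaylor
  have hterm (j : ℕ) (hj : j ≤ d + 1) :
      h ^ j / (j.factorial : ℝ) * (Real.exp (((k + j : ℕ) : ℝ) - ((k + d : ℕ) + 1)) * S (k + j))
        ≤ Real.exp ((k : ℝ) - ((k + d : ℕ) + 1)) * S k *
          ((h * Real.exp 1 * r) ^ j / (j.factorial : ℝ)) := by
    have he : Real.exp (((k + j : ℕ) : ℝ) - ((k + d : ℕ) + 1))
        = Real.exp ((k : ℝ) - ((k + d : ℕ) + 1)) * Real.exp 1 ^ j := by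
      rw [← Real.exp_nat_mul, ← Real.exp_add]
      congr 1
      push_cast
      ring
    rw [he]
    calc _ ≤ h ^ j / (j.factorial : ℝ) * (Real.exp ((k : ℝ) - ((k + d : ℕ) + 1)) *
            Real.exp 1 ^ j * (S k * r ^ j)) := by gcongr; exact hratio j hj
      _ = _ := by ring
  have hlast : S (k + d + 1) * h ^ (d + 1) / ((d + 1).factorial : ℝ)
      = h ^ (d + 1) / ((d + 1).factorial : ℝ) *
        (Real.exp (((k + (d + 1) : ℕ) : ℝ) - ((k + d : ℕ) + 1)) * S (k + (d + 1))) := by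
    have : (((k + (d + 1) : ℕ) : ℝ) - ((k + d : ℕ) + 1)) = 0 := by push_cast; ring
    rw [this, Real.exp_zero, one_mul, ← add_assoc]
    ring
  calc ‖iteratedDeriv k f (t + h)‖
      ≤ ‖∑ j ∈ Finset.range (d + 1), (h ^ j / (j.factorial : ℝ)) • iteratedDeriv (k + j) f t‖
        + S (k + d + 1) * h ^ (d + 1) / ((d + 1).factorial : ℝ) := by
        have := norm_le_norm_add_norm_sub' (iteratedDeriv k f (t + h))
          (∑ j ∈ Finset.range (d + 1), (h ^ j / (j.factorial : ℝ)) • iteratedDeriv (k + j) f t)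
        linarith
    _ ≤ ∑ j ∈ Finset.range (d + 1), h ^ j / (j.factorial : ℝ) *
          (Real.exp (((k + j : ℕ) : ℝ) - ((k + d : ℕ) + 1)) * S (k + j))
        + S (k + d + 1) * h ^ (d + 1) / ((d + 1).factorial : ℝ) := by
        gcongr
        refine norm_sum_le_of_le _ fun j _ => ?_
        rw [norm_smul, Real.norm_of_nonneg (by positivity)]
        gcongr
        exact ht (k + j)
    _ = ∑ j ∈ Finset.range (d + 2), h ^ j / (j.factorial : ℝ) *
          (Real.exp (((k + j : ℕ) : ℝ) - ((k + d : ℕ) + 1)) * S (k + j)) := by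
        rw [hlast, Finset.sum_range_succ _ (d + 1)]
    _ ≤ ∑ j ∈ Finset.range (d + 2), Real.exp ((k : ℝ) - ((k + d : ℕ) + 1)) * S k *
          ((h * Real.exp 1 * r) ^ j / (j.factorial : ℝ)) :=
        Finset.sum_le_sum fun j hj => hterm j (by have := Finset.mem_range.1 hj; omega)
    _ ≤ Real.exp ((k : ℝ) - ((k + d : ℕ) + 1)) * S k * Real.exp (h * Real.exp 1 * r) := by
        rw [← Finset.mul_sum]
        have := (hS k).le
        gcongr
        exact Real.sum_le_exp_of_nonneg (by positivity) _
    _ ≤ Real.exp ((k : ℝ) - ((k + d : ℕ) + 1)) * S k * Real.exp 1 := by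
        have := (hS k).le
        gcongr
    _ = Real.exp ((k : ℝ) - (k + d : ℕ)) * S k := by
        rw [mul_right_comm, ← Real.exp_add]
        congr 2
        ring

/-- The **Denjoy–Carleman theorem** for log-convex bounds: a smooth function whose derivatives are
bounded by a quasianalytic sequence and all vanish at `0` is zero on `[0, ∞)`. -/
theorem eq_zero_of_iteratedDeriv_zero_of_not_summable {E : Type*} [NormedAddCommGroup E]
    [NormedSpace ℝ E] {f : ℝ → E} (hf : ContDiff ℝ ∞ f) {S : ℕ → ℝ} (hS : ∀ n, 0 < S n)
    (hlog : Monotone fun n => S (n + 1) / S n) (hbound : ∀ n t, ‖iteratedDeriv n f t‖ ≤ S n)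
    (hzero : ∀ n, iteratedDeriv n f 0 = 0) (hdiv : ¬ Summable fun n => S n / S (n + 1))
    {t : ℝ} (ht : 0 ≤ t) : f t = 0 := by
  have hpos (n : ℕ) : 0 ≤ S n / S (n + 1) := (div_pos (hS _) (hS _)).le
  have hprop (d : ℕ) : ∀ (N : ℕ) (t : ℝ), 0 ≤ t →
      t ≤ Real.exp (-1) * ∑ i ∈ Finset.range d, S (N + i) / S (N + i + 1) →
      ∀ k : ℕ, ‖iteratedDeriv k f t‖ ≤ Real.exp ((k : ℝ) - N) * S k := by
    induction d with
    | zero =>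
      intro N t ht0 ht k
      obtain rfl : t = 0 := le_antisymm (by simpa using ht) ht0
      rw [hzero, norm_zero]
      have := hS k
      positivity
    | succ d ih =>
      intro N t ht0 ht k
      rw [Finset.sum_range_succ', mul_add] at ht
      simp only [add_zero] at ht
      set h := min t (Real.exp (-1) * (S N / S (N + 1))) with hdef
      have hh : 0 ≤ h := le_min ht0 (mul_nonneg (Real.exp_pos _).le (hpos N))
      rw [← sub_add_cancel t h]
      refine norm_iteratedDeriv_add_le_exp hf hS hlog hbound (fun k => ?_) hh (min_le_right _ _) k
      rw [← Nat.cast_add_one]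
      refine ih (N + 1) (t - h) (sub_nonneg.2 (min_le_left _ _)) ?_ k
      simp only [add_assoc, add_comm 1] at ht ⊢
      rcases min_choice t (Real.exp (-1) * (S N / S (N + 1))) with hm | hm
      · rw [hdef, hm, sub_self]
        exact mul_nonneg (Real.exp_pos _).le (Finset.sum_nonneg fun i _ => hpos _)
      · rw [hdef, hm]
        linarith
  have hle (N : ℕ) : ‖f t‖ ≤ Real.exp (-N) * S 0 := by
    have hN : ¬ Summable fun i => S (N + i) / S (N + i + 1) := by
      simpa only [add_comm _ N, add_assoc] using
        mt (summable_nat_add_iff (f := fun n => S n / S (n + 1)) N).1 hdiv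
    rw [not_summable_iff_tendsto_nat_atTop_of_nonneg fun i => hpos _] at hN
    obtain ⟨d, hd⟩ := (hN.eventually_ge_atTop (Real.exp 1 * t)).exists
    have := hprop d N t ht (by
      rw [Real.exp_neg, ← div_eq_inv_mul, le_div_iff₀ (Real.exp_pos 1), mul_comm]
      exact hd) 0
    simpa using this
  have hlim : Filter.Tendsto (fun N : ℕ => Real.exp (-N) * S 0) Filter.atTop (nhds 0) := by
    simpa using (Real.tendsto_exp_neg_atTop_nhds_zero.comp tendsto_natCast_atTop_atTop).mul_const
      (S 0)
  exact norm_le_zero_iff.1 (ge_of_tendsto' hlim hle)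

/-- Absolute moments are log-convex. -/
theorem sq_integral_abs_pow_le {ρ : Measure ℝ} (hρ : ∀ n : ℕ, Integrable (fun x => |x| ^ n) ρ)
    {n : ℕ} (hn : 0 < ∫ x, |x| ^ n ∂ρ) :
    (∫ x, |x| ^ (n + 1) ∂ρ) ^ 2 ≤ (∫ x, |x| ^ n ∂ρ) * ∫ x, |x| ^ (n + 2) ∂ρ := by
  set A := ∫ x, |x| ^ n ∂ρ
  set B := ∫ x, |x| ^ (n + 1) ∂ρ
  set D := ∫ x, |x| ^ (n + 2) ∂ρ
  have h0 : 0 ≤ ∫ x, |x| ^ n * (A * |x| - B) ^ 2 ∂ρ :=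
    integral_nonneg fun x => by positivity
  have h1 : ∫ x, |x| ^ n * (A * |x| - B) ^ 2 ∂ρ = A ^ 2 * D - 2 * A * B * B + B ^ 2 * A := by
    have : (fun x : ℝ => |x| ^ n * (A * |x| - B) ^ 2) = fun x =>
        A ^ 2 * |x| ^ (n + 2) - 2 * A * B * |x| ^ (n + 1) + B ^ 2 * |x| ^ n := by
      ext x
      ring
    rw [this, integral_add (f := fun x : ℝ => A ^ 2 * |x| ^ (n + 2) - 2 * A * B * |x| ^ (n + 1))
        (((hρ _).const_mul _).sub ((hρ _).const_mul _)) ((hρ _).const_mul _),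
      integral_sub ((hρ _).const_mul _) ((hρ _).const_mul _)]
    simp only [integral_const_mul, A, B, D]
  rw [h1] at h0
  refine le_of_mul_le_mul_left ?_ hn
  linarith

theorem norm_iteratedDeriv_charFun_le {μ : Measure ℝ} [IsFiniteMeasure μ] {n : ℕ}
    (hint : MemLp id n μ) (t : ℝ) : ‖iteratedDeriv n (charFun μ) t‖ ≤ ∫ x, |x| ^ n ∂μ := by
  rw [iteratedDeriv_charFun hint, norm_mul, norm_pow, Complex.norm_I, one_pow, one_mul]
  refine (norm_integral_le_integral_norm _).trans_eq ?_
  refine integral_congr_ae (Filter.Eventually.of_forall fun x => ?_)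
  simp only [norm_mul, norm_pow, Complex.norm_real, Real.norm_eq_abs]
  rw [← Complex.ofReal_mul, Complex.norm_exp_ofReal_mul_I, mul_one]

theorem memLp_id_of_integrable_pow {μ : Measure ℝ} [IsFiniteMeasure μ] {n : ℕ}
    (h : Integrable (fun x : ℝ => x ^ n) μ) : MemLp id n μ := by
  rcases eq_or_ne n 0 with rfl | hn
  · simpa using aestronglyMeasurable_id
  rw [← integrable_norm_rpow_iff aestronglyMeasurable_id (by exact_mod_cast hn) (by simp)]
  simpa using h.norm

theorem carleman_implies_determinate (μ : Measure ℝ) [IsProbabilityMeasure μ]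
    (hmom : ∀ m : ℕ, Integrable (fun x => x ^ m) μ)
    (hcar : ∑' k : ℕ, (ENNReal.ofReal (∫ x, x ^ (2 * (k + 1)) ∂μ)) ^
      (-(1 / (2 * ((k : ℝ) + 1)))) = ⊤)
    (ν : Measure ℝ) [IsProbabilityMeasure ν]
    (hνmom : ∀ m : ℕ, Integrable (fun x => x ^ m) ν)
    (heq : ∀ m : ℕ, ∫ x, x ^ m ∂ν = ∫ x, x ^ m ∂μ) :
    ν = μ := by
  have hμp (n : ℕ) : MemLp id n μ := memLp_id_of_integrable_pow (hmom n)
  have hνp (n : ℕ) : MemLp id n ν := memLp_id_of_integrable_pow (hνmom n)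
  have hμa (n : ℕ) : Integrable (fun x : ℝ => |x| ^ n) μ := by simpa using (hmom n).norm
  have hνa (n : ℕ) : Integrable (fun x : ℝ => |x| ^ n) ν := by simpa using (hνmom n).norm
  have hμc : ContDiff ℝ ∞ (charFun μ) := contDiff_charFun' hμp
  have hνc : ContDiff ℝ ∞ (charFun ν) := contDiff_charFun' hνp
  set S : ℕ → ℝ := fun n => ∫ x, |x| ^ n ∂(ν + μ)
  have hS0 (n : ℕ) : 0 ≤ S n := integral_nonneg fun x => by positivity
  have hSadd (n : ℕ) : S n = ∫ x, |x| ^ n ∂ν + ∫ x, |x| ^ n ∂μ :=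
    integral_add_measure (hνa n) (hμa n)
  have hSeven (k : ℕ) : S (2 * k) = 2 * ∫ x, x ^ (2 * k) ∂μ := by
    rw [hSadd]
    simp only [(even_two_mul k).pow_abs]
    rw [heq]
    exact (two_mul _).symm
  have hder (n : ℕ) (t : ℝ) : iteratedDeriv n (charFun ν - charFun μ) t
      = iteratedDeriv n (charFun ν) t - iteratedDeriv n (charFun μ) t :=
    iteratedDeriv_sub (hνc.of_le (by exact_mod_cast le_top)).contDiffAt
      (hμc.of_le (by exact_mod_cast le_top)).contDiffAt
  have hbound (n : ℕ) (t : ℝ) : ‖iteratedDeriv n (charFun ν - charFun μ) t‖ ≤ S n := by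
    rw [hder, hSadd]
    exact (norm_sub_le _ _).trans <| add_le_add (norm_iteratedDeriv_charFun_le (hνp n) t)
      (norm_iteratedDeriv_charFun_le (hμp n) t)
  have hzero (n : ℕ) : iteratedDeriv n (charFun ν - charFun μ) 0 = 0 := by
    rw [hder, iteratedDeriv_charFun_zero (hνp n), iteratedDeriv_charFun_zero (hμp n)]
    simp [heq]
  suffices h : ∀ t, 0 ≤ t → (charFun ν - charFun μ) t = 0 by
    refine Measure.ext_of_charFun (funext fun t => ?_)
    rcases le_total 0 t with ht | ht
    · exact sub_eq_zero.1 (h t ht)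
    · have := sub_eq_zero.1 (h (-t) (neg_nonneg.2 ht))
      simpa only [charFun_neg, (starRingEnd ℂ).injective.eq_iff] using this
  intro t ht
  by_cases hS : ∃ n, S n = 0
  · obtain ⟨n, hn⟩ := hS
    have := norm_sub_taylor_sum_le n (f := charFun ν - charFun μ) (hνc.sub hμc) (fun s => (hbound n s).trans_eq hn) 0 ht
    simpa [hzero] using this
  push Not at hS
  have hSpos (n : ℕ) : 0 < S n := (hS0 n).lt_of_ne' (hS n)
  refine eq_zero_of_iteratedDeriv_zero_of_not_summable (hνc.sub hμc) hSpos
    (monotone_nat_of_le_succ fun n => ?_) hbound hzero (fun hsum => ?_) ht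
  · rw [div_le_div_iff₀ (hSpos _) (hSpos _), ← sq, mul_comm]
    exact sq_integral_abs_pow_le (fun n => (hνa n).add_measure (hμa n)) (hSpos n)
  · have hprod (n : ℕ) : ∏ i ∈ Finset.range n, S i / S (i + 1) = S 0 / S n := by
      induction n with
      | zero => simp [hS 0]
      | succ n ih =>
        rw [Finset.prod_range_succ, ih, div_mul_div_cancel₀ (hS n)]
    have hs := summable_geom_mean (fun n => (div_pos (hSpos n) (hSpos (n + 1))).le) hsum
    simp only [hprod] at hs
    have hs' := hs.comp_injective (i := fun k : ℕ => 2 * k + 1) fun a b hab => by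
      simpa using hab
    refine hs'.tsum_ofReal_ne_top ((tsum_congr fun k => ?_).trans hcar)
    have hpos : 0 < ∫ x, x ^ (2 * (k + 1)) ∂μ := by
      have := hSpos (2 * (k + 1))
      rw [hSeven] at this
      linarith
    have hone : S 0 = 2 := by simpa using hSeven 0
    rw [ENNReal.ofReal_rpow_of_pos hpos, Real.rpow_neg hpos.le, ← Real.inv_rpow hpos.le]
    have h2 : 2 * k + 1 + 1 = 2 * (k + 1) := by ring
    simp only [Function.comp_apply, h2, hone, hSeven]
    congr 2
    · field_simp
    · push_cast
      ring
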